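/- arXiv:1208.5414 — 3 statements merged into one kernel-verified Lean document; each statement's English description precedes it below -/
import Mathlib

section
/- For a finite poset P, the unitary Tits form u_P is positive definite if and only if P is a chain. -/
open scoped Classical

/-- The unitary Tits form `u_P` of a finite poset `P = {p_1, …, p_t}` whose strict order
is given by the relation `r` (with `r i j` meaning `p_{i+1} ≺ p_{j+1}`):
`u_P(x_0, x) = x_0² + 2(Σᵢ xᵢ² + Σ_{pᵢ≺pⱼ} xᵢxⱼ − x_0 Σᵢ xᵢ)`. -/
noncomputable def uForm (t : ℕ) (r : Fin t → Fin t → Prop) (x0 : ℤ) (x : Fin t → ℤ) : ℤ :=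
  x0 ^ 2 + 2 * ((∑ i, x i ^ 2) + (∑ i, ∑ j, if r i j then x i * x j else 0)
    - x0 * ∑ i, x i)

theorem sum_sq_add_two_mul_sum_lt (t : ℕ) (x : Fin t → ℤ) :
    (∑ i, x i ^ 2) + 2 * (∑ i, ∑ j, if i < j then x i * x j else 0) = (∑ i, x i) ^ 2 := by
  have hdiag : ∑ i, x i ^ 2 = ∑ i, ∑ j, if i = j then x i * x j else 0 := by
    simp [sq]
  have hswap : (∑ i, ∑ j, if i < j then x i * x j else 0)
      = ∑ i, ∑ j, if j < i then x i * x j else 0 := by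
    rw [Finset.sum_comm]
    simp only [mul_comm]
  rw [two_mul]
  nth_rewrite 2 [hswap]
  rw [hdiag, sq, Finset.sum_mul_sum]
  simp only [← Finset.sum_add_distrib]
  refine Finset.sum_congr rfl fun i _ => Finset.sum_congr rfl fun j _ => ?_
  rcases lt_trichotomy i j with h | h | h
  · simp [h, h.ne, h.le]
  · simp [h]
  · simp [h, h.ne', h.le]

theorem uForm_of_chain (t : ℕ) (r : Fin t → Fin t → Prop) (h : ∀ i j, r i j ↔ i < j)
    (x0 : ℤ) (x : Fin t → ℤ) :
    uForm t r x0 x = (x0 - ∑ i, x i) ^ 2 + ∑ i, x i ^ 2 := by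
  have hsum : (∑ i, ∑ j, if r i j then x i * x j else 0)
      = ∑ i, ∑ j, if i < j then x i * x j else 0 := by
    simp only [h]
  rw [uForm, hsum]
  linear_combination sum_sq_add_two_mul_sum_lt t x

theorem uForm_eq_zero_of_incomparable (t : ℕ) (r : Fin t → Fin t → Prop)
    (henum : ∀ i j, r i j → i < j) {i j : Fin t} (hij : i < j) (hr : ¬ r i j) :
    uForm t r 2 (fun k => (if k = i then 1 else 0) + if k = j then 1 else 0) = 0 := by
  have hsum : (∑ a, ∑ b, if r a b then
      ((if a = i then (1 : ℤ) else 0) + if a = j then 1 else 0) *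
        ((if b = i then 1 else 0) + if b = j then 1 else 0) else 0) = 0 := by
    refine Finset.sum_eq_zero fun a _ => Finset.sum_eq_zero fun b _ => ?_
    have hab := henum a b
    grind
  have hsq : ∀ k, ((if k = i then (1 : ℤ) else 0) + if k = j then 1 else 0) ^ 2
      = (if k = i then 1 else 0) + if k = j then 1 else 0 := by
    intro k
    grind
  rw [uForm, hsum]
  simp only [hsq, Finset.sum_add_distrib, Finset.sum_ite_eq', Finset.mem_univ, if_true]
  norm_num

/-- For a finite poset `P` (elements enumerated so that `pᵢ ≺ pⱼ` implies `i < j`),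
the unitary Tits form `u_P` is positive definite if and only if `P` is a chain. -/
theorem uForm_positive_definite_iff_chain
    (t : ℕ) (r : Fin t → Fin t → Prop)
    (htrans : ∀ i j k, r i j → r j k → r i k)
    (henum : ∀ i j, r i j → i < j) :
    (∀ (x0 : ℤ) (x : Fin t → ℤ), ¬ (x0 = 0 ∧ ∀ i, x i = 0) → 0 < uForm t r x0 x) ↔
      (∀ i j : Fin t, r i j ↔ i < j) := by
  constructor
  · intro hpos i j
    refine ⟨henum i j, fun hij => ?_⟩
    by_contra hr
    exact (hpos 2 _ (by simp)).ne' (uForm_eq_zero_of_incomparable t r henum hij hr)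
  · intro h x0 x hx
    rw [uForm_of_chain t r h]
    have hnonneg : 0 ≤ ∑ i, x i ^ 2 := Finset.sum_nonneg fun i _ => sq_nonneg (x i)
    refine lt_of_le_of_ne (by positivity) fun h0 => hx ?_
    have hsq : ∑ i, x i ^ 2 = 0 := by nlinarith [sq_nonneg (x0 - ∑ i, x i)]
    have hzero : ∀ i, x i = 0 := fun i => by
      simpa using (Finset.sum_eq_zero_iff_of_nonneg fun i _ => sq_nonneg (x i)).1 hsq i
        (Finset.mem_univ i)
    refine ⟨?_, hzero⟩
    simpa [hzero] using h0.symm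
end

section
/- For a finite poset P, the unitary Tits form u_P is nonnegative definite if and only if P is a semichain. -/
open scoped Classical

/-- `P` is a semichain: it can be partitioned into blocks `P_1 ≺ P_2 ≺ … ≺ P_s`, each block
consisting of one element or of two incomparable elements.  Equivalently, there is a block-index
function `c` such that `pᵢ ≺ pⱼ` iff `c i < c j` and every fiber of `c` has at most two
elements. -/
def IsSemichain (t : ℕ) (r : Fin t → Fin t → Prop) : Prop :=
  ∃ c : Fin t → ℕ, (∀ i j, r i j ↔ c i < c j) ∧
    ∀ m : ℕ, (Finset.univ.filter fun i => c i = m).card ≤ 2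

/-- Two distinct indices are incomparable when `r` relates them in neither direction. -/
def Incomparable {ι : Type*} (r : ι → ι → Prop) (i j : ι) : Prop :=
  i ≠ j ∧ ¬ r i j ∧ ¬ r j i

theorem Incomparable.symm {ι : Type*} {r : ι → ι → Prop} {i j : ι} (h : Incomparable r i j) :
    Incomparable r j i :=
  ⟨h.1.symm, h.2.2, h.2.1⟩

theorem incomparable_comm {ι : Type*} {r : ι → ι → Prop} {i j : ι} :
    Incomparable r i j ↔ Incomparable r j i :=
  ⟨.symm, .symm⟩

/-- Completing the square in `x0`: what remains of the unitary Tits form only involves the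
incomparable pairs. -/
theorem uForm_eq_sq_add {t : ℕ} {r : Fin t → Fin t → Prop} (henum : ∀ i j, r i j → i < j)
    (x0 : ℤ) (x : Fin t → ℤ) :
    uForm t r x0 x = (x0 - ∑ i, x i) ^ 2 +
      ∑ i, x i * (x i - ∑ j, x j * if Incomparable r i j then 1 else 0) := by
  have hsq : (∑ i, x i) ^ 2 = (∑ i, x i ^ 2) + 2 * (∑ i, ∑ j, if r i j then x i * x j else 0)
      + ∑ i, x i * ∑ j, x j * if Incomparable r i j then 1 else 0 := by
    have hswap : (∑ i, ∑ j, if r i j then x i * x j else 0) =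
        ∑ i, ∑ j, if r j i then x j * x i else 0 := Finset.sum_comm
    have hdiag : ∑ i, x i ^ 2 = ∑ i, ∑ j, if i = j then x i * x j else 0 := by
      simp [sq]
    rw [two_mul]
    nth_rw 2 [hswap]
    rw [hdiag, sq, Finset.sum_mul_sum]
    simp only [Finset.mul_sum, ← Finset.sum_add_distrib]
    refine Finset.sum_congr rfl fun i _ => Finset.sum_congr rfl fun j _ => ?_
    have hij := henum i j
    have hji := henum j i
    unfold Incomparable
    rcases lt_trichotomy i j with h | h | h
    · have h' : ¬ r j i := fun h' => (hji h').not_gt h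
      by_cases hr : r i j <;> simp [h.ne, h', hr]
    · subst h
      have h' : ¬ r i i := fun h' => (hij h').false
      simp [h']
    · have h' : ¬ r i j := fun h' => (hij h').not_gt h
      by_cases hr : r j i <;> simp [h.ne', h', hr, mul_comm]
  simp only [mul_sub, Finset.sum_sub_distrib, uForm, ← sq]
  linear_combination -hsq

theorem sum_mul_sub_nonneg_of_incomparable_unique {ι : Type*} [Fintype ι] {r : ι → ι → Prop}
    (hr : ∀ i j k, Incomparable r i j → Incomparable r i k → j = k) (x : ι → ℤ) :
    0 ≤ ∑ i, x i * (x i - ∑ j, x j * if Incomparable r i j then 1 else 0) := by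
  have hdeg (i : ι) : (∑ j, if Incomparable r i j then x i ^ 2 else 0) ≤ x i ^ 2 := by
    rw [← Finset.sum_filter, Finset.sum_const, nsmul_eq_mul]
    have hcard : (Finset.univ.filter (Incomparable r i)).card ≤ 1 :=
      Finset.card_le_one.2 fun a ha b hb =>
        hr i a b (Finset.mem_filter.1 ha).2 (Finset.mem_filter.1 hb).2
    exact mul_le_of_le_one_left (sq_nonneg _) (mod_cast hcard)
  have hswap : (∑ i, ∑ j, if Incomparable r i j then x j ^ 2 else 0) =
      ∑ i, ∑ j, if Incomparable r i j then x i ^ 2 else 0 := by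
    rw [Finset.sum_comm]
    simp only [incomparable_comm (r := r)]
  have hpair : 2 * (∑ i, x i * ∑ j, x j * if Incomparable r i j then 1 else 0) ≤
      (∑ i, ∑ j, if Incomparable r i j then x i ^ 2 else 0) +
        ∑ i, ∑ j, if Incomparable r i j then x j ^ 2 else 0 := by
    simp only [Finset.mul_sum, ← Finset.sum_add_distrib]
    refine Finset.sum_le_sum fun i _ => Finset.sum_le_sum fun j _ => ?_
    split_ifs
    · nlinarith [sq_nonneg (x i - x j)]
    · simp
  have hsum := Finset.sum_le_sum fun i (_ : i ∈ Finset.univ) => hdeg i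
  simp only [mul_sub, Finset.sum_sub_distrib, ← sq]
  linarith

theorem incomparable_unique_of_uForm_nonneg {t : ℕ} {r : Fin t → Fin t → Prop}
    (henum : ∀ i j, r i j → i < j) (hpos : ∀ (x0 : ℤ) (x : Fin t → ℤ), 0 ≤ uForm t r x0 x)
    (i j k : Fin t) (hij : Incomparable r i j) (hik : Incomparable r i k) : j = k := by
  by_contra hjk
  let x : Fin t → ℤ := Pi.single i 2 + Pi.single j 1 + Pi.single k 1
  have hsum (f : Fin t → ℤ) : ∑ a, x a * f a = 2 * f i + f j + f k := by
    simp [x, add_mul, Finset.sum_add_distrib, Pi.single_apply]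
  have hself (a : Fin t) : ¬ Incomparable r a a := fun h => h.1 rfl
  have h := hpos (∑ a, x a) x
  rw [uForm_eq_sq_add henum, hsum] at h
  simp only [hsum, hij, hik, hij.symm, hik.symm, hself, if_true, if_false] at h
  have hxi : x i = 2 := by simp [x, hij.1, hik.1]
  have hxj : x j = 1 := by simp [x, hij.1.symm, hjk]
  have hxk : x k = 1 := by simp [x, hik.1.symm, Ne.symm hjk]
  rw [hxi, hxj, hxk] at h
  split_ifs at h <;> norm_num at h

theorem IsSemichain.incomparable_unique {t : ℕ} {r : Fin t → Fin t → Prop}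
    (h : IsSemichain t r) (i j k : Fin t) (hij : Incomparable r i j)
    (hik : Incomparable r i k) : j = k := by
  obtain ⟨c, hc, hcard⟩ := h
  have heq {a : Fin t} (ha : Incomparable r i a) : c a = c i := by
    have h1 := ha.2.1
    have h2 := ha.2.2
    rw [hc] at h1 h2
    omega
  by_contra hjk
  exact (hcard (c i)).not_gt <| Finset.two_lt_card.2
    ⟨i, by simp, j, by simp [heq hij], k, by simp [heq hik], hij.1, hik.1, hjk⟩

theorem isSemichain_of_incomparable_unique {t : ℕ} {r : Fin t → Fin t → Prop}
    (htrans : ∀ i j k, r i j → r j k → r i k) (henum : ∀ i j, r i j → i < j)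
    (hr : ∀ i j k, Incomparable r i j → Incomparable r i k → j = k) : IsSemichain t r := by
  have hirr (i : Fin t) : ¬ r i i := fun h => (henum i i h).false
  let c : Fin t → ℕ := fun i => (Finset.univ.filter fun j => r j i).card
  have hlt {i j : Fin t} (h : r i j) : c i < c j := by
    refine Finset.card_lt_card (Finset.ssubset_iff_subset_ne.2 ⟨fun a ha => ?_, fun heq => ?_⟩)
    · simp only [Finset.mem_filter, Finset.mem_univ, true_and] at ha ⊢
      exact htrans a i j ha h
    · have hi : i ∈ Finset.univ.filter fun a => r a j := by simpa using h
      rw [← heq] at hi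
      exact hirr i (Finset.mem_filter.1 hi).2
  have hpred {i j p : Fin t} (h : Incomparable r i j) (hp : r p i) : r p j := by
    by_contra hpj
    have hjp : Incomparable r j p :=
      ⟨fun e => h.2.2 (e ▸ hp), fun hjp => h.2.2 (htrans j p i hjp hp), hpj⟩
    exact hirr i ((hr j i p h.symm hjp).symm ▸ hp)
  have heq {i j : Fin t} (h : Incomparable r i j) : c i = c j :=
    congrArg Finset.card <| Finset.filter_congr fun p _ => ⟨hpred h, hpred h.symm⟩
  refine ⟨c, fun i j => ⟨hlt, fun h => ?_⟩, fun m => ?_⟩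
  · by_contra hij
    exact h.ne (heq ⟨fun e => h.ne (congrArg c e), hij, fun hji => (hlt hji).not_gt h⟩)
  · by_contra! hm
    obtain ⟨i, hi, j, hj, k, hk, hij, hik, hjk⟩ := Finset.two_lt_card.1 hm
    simp only [Finset.mem_filter, Finset.mem_univ, true_and] at hi hj hk
    have hinc {a b : Fin t} (hab : a ≠ b) (h : c a = c b) : Incomparable r a b :=
      ⟨hab, fun h' => (hlt h').ne h, fun h' => (hlt h').ne' h⟩
    exact hjk (hr i j k (hinc hij (hi.trans hj.symm)) (hinc hik (hi.trans hk.symm)))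

/-- For a finite poset `P` (elements enumerated so that `pᵢ ≺ pⱼ` implies `i < j`),
the unitary Tits form `u_P` is nonnegative definite if and only if `P` is a semichain. -/
theorem uForm_nonnegative_definite_iff_semichain
    (t : ℕ) (r : Fin t → Fin t → Prop)
    (htrans : ∀ i j k, r i j → r j k → r i k)
    (henum : ∀ i j, r i j → i < j) :
    (∀ (x0 : ℤ) (x : Fin t → ℤ), 0 ≤ uForm t r x0 x) ↔ IsSemichain t r := by
  refine ⟨fun h => isSemichain_of_incomparable_unique htrans henum
    (incomparable_unique_of_uForm_nonneg henum h), fun h x0 x => ?_⟩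
  rw [uForm_eq_sq_add henum]
  exact add_nonneg (sq_nonneg _) (sum_mul_sub_nonneg_of_incomparable_unique h.incomparable_unique x)
end

section
/- Let P = {p_1,…,p_t} be a chain and let A = [A_1|…|A_t] be a block matrix over ℂ with m rows, block A_i of size m × n_i. Then there exist an m×m unitary matrix R, an invertible block upper triangular matrix S = [S_{ij}]_{i≤j} (S_{ij} of size n_i × n_j), and nonnegative integers r_1,…,r_t with r_1+…+r_t ≤ m such that B = R A S has the staircase form: for each i, the block B_i has entry 1 in position (r_1+…+r_{i−1}+l, l) for l = 1,…,r_i and all other entries 0. Moreover the integers r_1,…,r_t are uniquely determined by A (they do not depend on the choice of R and S producing such a form). -/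
open scoped Classical

/-- The staircase block matrix determined by ranks `rk : Fin t → ℕ`: the `i`-th block has
entry `1` in position `(rk 0 + … + rk (i−1) + l, l)` for `l = 0, …, rk i − 1` and all other
entries `0`. -/
noncomputable def stairBlock (t m : ℕ) (n : Fin t → ℕ) (rk : Fin t → ℕ) (i : Fin t) :
    Matrix (Fin m) (Fin (n i)) ℂ := fun row c =>
  if (row : ℕ) = (∑ i' ∈ Finset.univ.filter fun i' => i' < i, rk i') + (c : ℕ) ∧
      (c : ℕ) < rk i then 1 else 0

open Module

/-- A basis of the range of a linear map lifts to a basis of the source whose remaining members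
lie in the kernel. -/
lemma exists_basis_apply_eq_ite {K V F : Type*} [Field K] [AddCommGroup V] [Module K V]
    [AddCommGroup F] [Module K F] [FiniteDimensional K V] {n r : ℕ} (hn : finrank K V = n)
    (φ : V →ₗ[K] F) (b : Basis (Fin r) K (LinearMap.range φ)) :
    ∃ D : Basis (Fin n) K V, ∀ c, φ (D c) = if h : c.1 < r then (b ⟨c, h⟩ : F) else 0 := by
  have hr : finrank K (LinearMap.range φ) = r := by simpa using finrank_eq_card_basis b
  have hrk := φ.finrank_range_add_finrank_ker
  let B := Basis.sumQuot (finBasis K (LinearMap.ker φ)) (b.map φ.quotKerEquivRange.symm)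
  let e : Fin (finrank K (LinearMap.ker φ)) ⊕ Fin r ≃ Fin n :=
    (Equiv.sumComm _ _).trans (finSumFinEquiv.trans (finCongr (by omega)))
  refine ⟨B.reindex e, fun c => ?_⟩
  obtain ⟨x, rfl⟩ := e.surjective c
  rw [Basis.reindex_apply, Equiv.symm_apply_apply]
  rcases x with k | l
  · have : ¬ ((e (Sum.inl k)).1 < r) := by simp [e]
    rw [dif_neg this, Basis.sumQuot_inl]
    exact (finBasis K (LinearMap.ker φ) k).2
  · have : (e (Sum.inr l)).1 = l.1 := by simp [e]
    rw [dif_pos (by omega)]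
    have h := Basis.sumQuot_inr (finBasis K (LinearMap.ker φ))
      (b.map φ.quotKerEquivRange.symm) l
    have h2 := congrArg φ.quotKerEquivRange h
    rw [Basis.map_apply, LinearEquiv.apply_symm_apply] at h2
    have h3 := congrArg Subtype.val h2
    rw [LinearMap.quotKerEquivRange_apply_mk] at h3
    simp only [this, Fin.eta]
    exact h3

/-- Block Gram–Schmidt: modulo the ranges of earlier blocks, suitable bases of the sources of a
family of linear maps are sent to an orthonormal family completed by zeros. -/
lemma exists_orthonormal_block_reduction {E : Type*} [NormedAddCommGroup E]
    [InnerProductSpace ℂ E] [FiniteDimensional ℂ E] {t : ℕ} {n : Fin t → ℕ}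
    (a : ∀ i, (Fin (n i) → ℂ) →ₗ[ℂ] E) :
    ∃ (rk : Fin t → ℕ) (u : (Σ i, Fin (rk i)) → E)
      (D : ∀ i, Basis (Fin (n i)) ℂ (Fin (n i) → ℂ))
      (s : ∀ i, Fin (n i) → ∀ k, Fin (n k) → ℂ),
      (∀ i, rk i ≤ n i) ∧ Orthonormal ℂ u ∧
      ∀ i c, a i (D i c) + ∑ k ∈ Finset.Iio i, a k (s i c k) =
        if h : c.1 < rk i then u ⟨i, ⟨c, h⟩⟩ else 0 := by
  let L : ∀ _ : Fin t, (∀ k, Fin (n k) → ℂ) →ₗ[ℂ] E := fun i =>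
    ∑ k ∈ Finset.Iio i, a k ∘ₗ LinearMap.proj k
  have hL : ∀ i x, L i x = ∑ k ∈ Finset.Iio i, a k (x k) := fun i x => by simp [L]
  let V : Fin t → Submodule ℂ E := fun i => LinearMap.range (L i)
  have haV : ∀ i j, i < j → ∀ x, a i x ∈ V j := by
    intro i j hij x
    refine ⟨Pi.single i x, ?_⟩
    rw [hL, Finset.sum_eq_single i]
    · simp
    · intro k _ hk
      simp [Pi.single_eq_of_ne hk]
    · intro h
      exact absurd (Finset.mem_Iio.2 hij) h
  have hV : ∀ i j, i ≤ j → V i ≤ V j := by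
    rintro i j hij _ ⟨x, rfl⟩
    rw [hL]
    exact Submodule.sum_mem _ fun k hk => haV _ _ ((Finset.mem_Iio.1 hk).trans_le hij) _
  let φ : ∀ i, (Fin (n i) → ℂ) →ₗ[ℂ] E := fun i => ((V i)ᗮ.starProjection : E →ₗ[ℂ] E) ∘ₗ a i
  have hφ : ∀ i x, φ i x = a i x - (V i).starProjection (a i x) := fun i x => by
    simp [φ, Submodule.starProjection_orthogonal]
  let U : Fin t → Submodule ℂ E := fun i => LinearMap.range (φ i)
  have horth : ∀ i j, i < j → ∀ x ∈ U i, ∀ y ∈ U j, inner ℂ x y = 0 := by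
    rintro i j hij _ ⟨x, rfl⟩ _ ⟨y, rfl⟩
    refine (Submodule.mem_orthogonal (V j) _).1 ?_ _ ?_
    · exact Submodule.starProjection_apply_mem _ _
    · rw [hφ]
      exact Submodule.sub_mem _ (haV _ _ hij _)
        (hV _ _ hij.le (Submodule.starProjection_apply_mem _ _))
  have hU : OrthogonalFamily ℂ (fun i => U i) fun i => (U i).subtypeₗᵢ := by
    intro i j hij x y
    rcases lt_or_gt_of_ne hij with h | h
    · exact horth i j h _ x.2 _ y.2
    · exact inner_eq_zero_symm.1 (horth j i h _ y.2 _ x.2)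
  let w : ∀ i, OrthonormalBasis (Fin (finrank ℂ (U i))) ℂ (U i) := fun i =>
    stdOrthonormalBasis ℂ (U i)
  have hD := fun i => exists_basis_apply_eq_ite (n := n i) (by simp) (φ i) (w i).toBasis
  choose D hD using hD
  have hs : ∀ i c, ∃ x, L i x = - (V i).starProjection (a i (D i c)) := fun i c =>
    Submodule.neg_mem _ (Submodule.starProjection_apply_mem (V i) (a i (D i c)))
  choose s hs using hs
  refine ⟨fun i => finrank ℂ (U i), fun p => (w p.1 p.2 : E), D, s, fun i => ?_, ?_, fun i c => ?_⟩
  · simpa using (φ i).finrank_range_le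
  · exact hU.orthonormal_sigma_orthonormal fun i => (w i).orthonormal
  · rw [← hL, hs, ← sub_eq_add_neg, ← hφ, hD]
    simp

/-- A block upper triangular family with invertible diagonal blocks has a two-sided block
inverse. -/
lemma exists_block_inverse {t : ℕ} {n : Fin t → ℕ}
    (S : ∀ i j : Fin t, Matrix (Fin (n i)) (Fin (n j)) ℂ)
    (hS : ∀ i j, j < i → S i j = 0) (hdiag : ∀ i, IsUnit (S i i).det) :
    ∃ S' : ∀ i j : Fin t, Matrix (Fin (n i)) (Fin (n j)) ℂ,
      (∀ i, ∑ k, S i k * S' k i = 1) ∧ (∀ i j, i ≠ j → ∑ k, S i k * S' k j = 0) ∧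
      (∀ i, ∑ k, S' i k * S k i = 1) ∧ (∀ i j, i ≠ j → ∑ k, S' i k * S k j = 0) := by
  let M : Matrix (Σ i, Fin (n i)) (Σ i, Fin (n i)) ℂ := fun p q => S p.1 q.1 p.2 q.2
  have hM : M.BlockTriangular Sigma.fst := fun p q h => by simp [M, hS _ _ h]
  have hdet : IsUnit M.det := by
    rw [hM.det_fintype, isUnit_iff_ne_zero, Finset.prod_ne_zero_iff]
    intro i _
    have : M.toSquareBlock Sigma.fst i =
        (S i i).submatrix (Equiv.sigmaSubtype i) (Equiv.sigmaSubtype i) := by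
      ext ⟨⟨p, c⟩, hp⟩ ⟨⟨q, d⟩, hq⟩
      obtain rfl : p = i := hp
      obtain rfl : q = p := hq
      rfl
    rw [this, Matrix.det_submatrix_equiv_self]
    exact (hdiag i).ne_zero
  have hmul : ∀ (X Y : Matrix (Σ i, Fin (n i)) (Σ i, Fin (n i)) ℂ) (i j) (c d),
      (∑ k, (Matrix.of fun c d => X ⟨i, c⟩ ⟨k, d⟩ : Matrix (Fin (n i)) (Fin (n k)) ℂ) *
        (Matrix.of fun c d => Y ⟨k, c⟩ ⟨j, d⟩ : Matrix (Fin (n k)) (Fin (n j)) ℂ)) c d =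
        (X * Y) ⟨i, c⟩ ⟨j, d⟩ := by
    intro X Y i j c d
    rw [Matrix.sum_apply, Matrix.mul_apply, Fintype.sum_sigma]
    rfl
  refine ⟨fun i j => Matrix.of fun c d => M⁻¹ ⟨i, c⟩ ⟨j, d⟩, ?_, ?_, ?_, ?_⟩
  · intro i
    ext c d
    refine (hmul M M⁻¹ i i c d).trans ?_
    rw [Matrix.mul_nonsing_inv _ hdet]
    simp [Matrix.one_apply]
  · intro i j hij
    ext c d
    refine (hmul M M⁻¹ i j c d).trans ?_
    rw [Matrix.mul_nonsing_inv _ hdet]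
    simp [hij]
  · intro i
    ext c d
    refine (hmul M⁻¹ M i i c d).trans ?_
    rw [Matrix.nonsing_inv_mul _ hdet]
    simp [Matrix.one_apply]
  · intro i j hij
    ext c d
    refine (hmul M⁻¹ M i j c d).trans ?_
    rw [Matrix.nonsing_inv_mul _ hdet]
    simp [hij]

/-- A two-sided block inverse of a block upper triangular family is block upper triangular. -/
lemma block_inverse_upper_triangular {t : ℕ} {n : Fin t → ℕ}
    (S S' : ∀ i j : Fin t, Matrix (Fin (n i)) (Fin (n j)) ℂ)
    (hS : ∀ i j, j < i → S i j = 0)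
    (h₁ : ∀ i, ∑ k, S i k * S' k i = 1) (h₂ : ∀ i j, i ≠ j → ∑ k, S i k * S' k j = 0) :
    ∀ i j, j < i → S' i j = 0 := by
  let M : Matrix (Σ i, Fin (n i)) (Σ i, Fin (n i)) ℂ := fun p q => S p.1 q.1 p.2 q.2
  let N : Matrix (Σ i, Fin (n i)) (Σ i, Fin (n i)) ℂ := fun p q => S' p.1 q.1 p.2 q.2
  have hM : M.BlockTriangular Sigma.fst := fun p q h => by simp [M, hS _ _ h]
  have hMN : M * N = 1 := by
    ext ⟨i, c⟩ ⟨j, d⟩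
    have : (M * N) ⟨i, c⟩ ⟨j, d⟩ = (∑ k, S i k * S' k j) c d := by
      rw [Matrix.sum_apply, Matrix.mul_apply, Fintype.sum_sigma]
      rfl
    rw [this]
    by_cases hij : i = j
    · subst hij
      rw [h₁]
      simp [Matrix.one_apply]
    · rw [h₂ _ _ hij]
      simp [hij]
  let _ := invertibleOfRightInverse M N hMN
  have hN := Matrix.blockTriangular_inv_of_blockTriangular hM
  rw [Matrix.inv_eq_right_inv hMN] at hN
  intro i j hij
  ext c d
  exact hN (i := ⟨i, c⟩) (j := ⟨j, d⟩) hij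

/-- The span of the columns of the blocks with index at most `i`. -/
def blockColSpan {t m : ℕ} {n : Fin t → ℕ} (A : ∀ i : Fin t, Matrix (Fin m) (Fin (n i)) ℂ)
    (i : Fin t) : Submodule ℂ (Fin m → ℂ) :=
  Submodule.span ℂ {x | ∃ k c, k ≤ i ∧ (A k).col c = x}

lemma blockColSpan_mul_le {t m : ℕ} {n : Fin t → ℕ}
    (A : ∀ i : Fin t, Matrix (Fin m) (Fin (n i)) ℂ)
    (S : ∀ i j : Fin t, Matrix (Fin (n i)) (Fin (n j)) ℂ)
    (hS : ∀ i j, j < i → S i j = 0) (i : Fin t) :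
    blockColSpan (fun i => ∑ k, A k * S k i) i ≤ blockColSpan A i := by
  refine Submodule.span_le.2 ?_
  rintro _ ⟨k, c, hk, rfl⟩
  have : (∑ j, A j * S j k).col c = ∑ j, ∑ d, S j k d c • (A j).col d := by
    ext row
    simp [Matrix.sum_apply, Matrix.mul_apply, mul_comm]
  rw [this]
  refine Submodule.sum_mem _ fun j _ => Submodule.sum_mem _ fun d _ => ?_
  by_cases hj : j ≤ k
  · exact Submodule.smul_mem _ _ (Submodule.subset_span ⟨j, d, hj.trans hk, rfl⟩)
  · simp [hS j k (not_le.1 hj)]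

lemma finrank_blockColSpan_mul_le {t m : ℕ} {n : Fin t → ℕ} (R : Matrix (Fin m) (Fin m) ℂ)
    (A : ∀ i : Fin t, Matrix (Fin m) (Fin (n i)) ℂ) (i : Fin t) :
    finrank ℂ (blockColSpan (fun i => R * A i) i) ≤ finrank ℂ (blockColSpan A i) := by
  refine le_trans (Submodule.finrank_mono ?_) (Submodule.finrank_map_le R.mulVecLin _)
  refine Submodule.span_le.2 ?_
  rintro _ ⟨k, c, hk, rfl⟩
  refine ⟨(A k).col c, Submodule.subset_span ⟨k, c, hk, rfl⟩, ?_⟩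
  ext row
  simp [Matrix.mul_apply, Matrix.mulVec, dotProduct]

lemma finSigmaFinEquiv_val_eq_sum_filter {t : ℕ} {rk : Fin t → ℕ} (p : Σ i, Fin (rk i)) :
    (finSigmaFinEquiv p : ℕ) =
      (∑ i' ∈ Finset.univ.filter fun i' => i' < p.1, rk i') + (p.2 : ℕ) := by
  rw [finSigmaFinEquiv_apply]
  congr 1
  refine Finset.sum_nbij (fun i => Fin.castLE p.1.2.le i) ?_ ?_ ?_ ?_
  · intro i _
    exact Finset.mem_filter.2 ⟨Finset.mem_univ _, i.2⟩
  · intro i _ j _ h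
    simpa using h
  · intro i hi
    simp only [Finset.coe_filter, Finset.mem_univ, true_and, Set.mem_ofPred_eq, Fin.lt_def] at hi
    exact ⟨⟨i, hi⟩, by simp, rfl⟩
  · intro i _
    rfl

lemma stairBlock_col {t m : ℕ} {n rk : Fin t → ℕ} (hm : ∑ i, rk i ≤ m) (i : Fin t)
    (c : Fin (n i)) :
    (stairBlock t m n rk i).col c =
      if h : c.1 < rk i then Pi.single (Fin.castLE hm (finSigmaFinEquiv ⟨i, ⟨c, h⟩⟩)) 1 else 0 := by
  ext row
  split_ifs with h
  · simp only [stairBlock, Matrix.col_apply, Pi.single_apply, Fin.ext_iff, Fin.val_castLE,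
      finSigmaFinEquiv_val_eq_sum_filter, h, and_true]
  · simp [stairBlock, h]

lemma finrank_blockColSpan_stairBlock {t m : ℕ} {n rk : Fin t → ℕ} (hm : ∑ i, rk i ≤ m)
    (hn : ∀ i, rk i ≤ n i) (i : Fin t) :
    finrank ℂ (blockColSpan (stairBlock t m n rk) i) = ∑ k ∈ Finset.Iic i, rk k := by
  let f : {p : Σ i, Fin (rk i) // p.1 ≤ i} → Fin m := fun p => Fin.castLE hm (finSigmaFinEquiv p.1)
  have hf : Function.Injective f := fun p q h =>
    Subtype.ext (finSigmaFinEquiv.injective (Fin.castLE_injective hm h))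
  let v : {p : Σ i, Fin (rk i) // p.1 ≤ i} → Fin m → ℂ := fun p => Pi.single (f p) 1
  have hv : LinearIndependent ℂ v := by
    have := (Pi.basisFun ℂ (Fin m)).linearIndependent.comp f hf
    convert this using 1
    ext p
    simp [v]
  have hspan : blockColSpan (stairBlock t m n rk) i = Submodule.span ℂ (Set.range v) := by
    apply le_antisymm
    · refine Submodule.span_le.2 ?_
      rintro _ ⟨k, c, hk, rfl⟩
      rw [stairBlock_col hm]
      split_ifs with h
      · exact Submodule.subset_span ⟨⟨⟨k, ⟨c, h⟩⟩, hk⟩, rfl⟩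
      · exact Submodule.zero_mem _
    · refine Submodule.span_mono ?_
      rintro _ ⟨⟨⟨k, c⟩, hk⟩, rfl⟩
      refine ⟨k, ⟨c, c.2.trans_le (hn k)⟩, hk, ?_⟩
      rw [stairBlock_col hm, dif_pos c.2]
  rw [hspan, finrank_span_eq_card hv, Fintype.card_congr (Equiv.subtypeSigmaEquiv _ (· ≤ i)),
    Fintype.card_sigma]
  simp only [Fintype.card_fin]
  exact (Finset.sum_subtype _ (by simp) rk).symm

/-- The partial sums of the staircase ranks are the dimensions of the initial column spans. -/
lemma sum_Iic_eq_finrank_blockColSpan {t m : ℕ} {n rk : Fin t → ℕ}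
    {A : ∀ i : Fin t, Matrix (Fin m) (Fin (n i)) ℂ} (hm : ∑ i, rk i ≤ m) (hn : ∀ i, rk i ≤ n i)
    {R : Matrix (Fin m) (Fin m) ℂ} {S S' : ∀ i j : Fin t, Matrix (Fin (n i)) (Fin (n j)) ℂ}
    (hR : R ∈ Matrix.unitaryGroup (Fin m) ℂ) (hS : ∀ i j, j < i → S i j = 0)
    (h₁ : ∀ i, ∑ k, S i k * S' k i = 1) (h₂ : ∀ i j, i ≠ j → ∑ k, S i k * S' k j = 0)
    (hB : ∀ i, R * ∑ k, A k * S k i = stairBlock t m n rk i) (i : Fin t) :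
    ∑ k ∈ Finset.Iic i, rk k = finrank ℂ (blockColSpan A i) := by
  have hS' := block_inverse_upper_triangular S S' hS h₁ h₂
  rw [← finrank_blockColSpan_stairBlock hm hn]
  have hB' : stairBlock t m n rk = fun i => R * ∑ k, A k * S k i := funext fun i => (hB i).symm
  have hC : (fun i => star R * stairBlock t m n rk i) = fun i => ∑ k, A k * S k i := by
    funext i
    rw [← hB, ← Matrix.mul_assoc, Matrix.mem_unitaryGroup_iff'.1 hR, Matrix.one_mul]
  have hA : (fun i => ∑ j, (∑ k, A k * S k j) * S' j i) = A := by
    funext i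
    simp_rw [Matrix.sum_mul, Matrix.mul_assoc]
    rw [Finset.sum_comm]
    simp_rw [← Matrix.mul_sum]
    rw [Finset.sum_eq_single i]
    · rw [h₁, Matrix.mul_one]
    · intro k _ hk
      rw [h₂ _ _ hk, Matrix.mul_zero]
    · simp
  apply le_antisymm
  · rw [hB']
    exact (finrank_blockColSpan_mul_le R _ i).trans
      (Submodule.finrank_mono (blockColSpan_mul_le A S hS i))
  · have h := blockColSpan_mul_le (fun j => ∑ k, A k * S k j) S' hS' i
    rw [hA] at h
    refine (Submodule.finrank_mono h).trans ?_
    rw [← hC]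
    exact finrank_blockColSpan_mul_le _ _ i

lemma eq_of_sum_Iic_eq {t : ℕ} {f g : Fin t → ℕ}
    (h : ∀ i, ∑ k ∈ Finset.Iic i, f k = ∑ k ∈ Finset.Iic i, g k) : f = g := by
  funext i
  induction i using WellFoundedLT.induction with
  | ind i ih =>
    have hi := h i
    rw [← Finset.Iio_insert, Finset.sum_insert (by simp), Finset.sum_insert (by simp),
      Finset.sum_congr rfl fun k hk => ih k (Finset.mem_Iio.1 hk)] at hi
    exact Nat.add_right_cancel hi

lemma exists_staircase_form {t m : ℕ} {n : Fin t → ℕ}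
    (A : ∀ i : Fin t, Matrix (Fin m) (Fin (n i)) ℂ) :
    ∃ rk : Fin t → ℕ, (∑ i, rk i) ≤ m ∧ (∀ i, rk i ≤ n i) ∧
      ∃ (R : Matrix (Fin m) (Fin m) ℂ)
        (S : ∀ i j : Fin t, Matrix (Fin (n i)) (Fin (n j)) ℂ),
        R ∈ Matrix.unitaryGroup (Fin m) ℂ ∧ (∀ i j, j < i → S i j = 0) ∧
        (∀ i, IsUnit (S i i).det) ∧ ∀ i, R * ∑ k, A k * S k i = stairBlock t m n rk i := by
  let e := (WithLp.linearEquiv 2 ℂ (Fin m → ℂ)).symm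
  obtain ⟨rk, u, D, s, hn, hu, hD⟩ := exists_orthonormal_block_reduction
    fun i => e.toLinearMap ∘ₗ (A i).mulVecLin
  have hm : ∑ i, rk i ≤ m := by
    simpa using hu.linearIndependent.fintype_card_le_finrank
  let ι : (Σ i, Fin (rk i)) → Fin m := fun p => Fin.castLE hm (finSigmaFinEquiv p)
  have hι : Function.Injective ι := (Fin.castLE_injective hm).comp finSigmaFinEquiv.injective
  let v : Fin m → EuclideanSpace ℂ (Fin m) := Function.extend ι u 0
  have hv : Orthonormal ℂ ((Set.range ι).domRestrict v) := by
    have h : (Set.range ι).domRestrict v ∘ Equiv.ofInjective ι hι = u := by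
      funext p
      exact hι.extend_apply _ _ _
    rw [← h] at hu
    have := hu.comp (Equiv.ofInjective ι hι).symm (Equiv.injective _)
    simpa [Function.comp_assoc] using this
  obtain ⟨b, hb⟩ := hv.exists_orthonormalBasis_extension_of_card_eq (by simp)
  have hbu : ∀ p, b (ι p) = u p := fun p => by
    rw [hb _ ⟨p, rfl⟩]
    exact hι.extend_apply _ _ _
  let R := b.toBasis.toMatrix (EuclideanSpace.basisFun (Fin m) ℂ)
  have hR : ∀ x : Fin m → ℂ, R.mulVec x = b.repr (e x) := fun x => by
    have h := Basis.toMatrix_mulVec_repr (b := (EuclideanSpace.basisFun (Fin m) ℂ).toBasis)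
      (b' := b.toBasis) (e x)
    have h₁ : ⇑((EuclideanSpace.basisFun (Fin m) ℂ).toBasis.repr (e x)) = x := by
      ext j
      simp [e]
    rw [h₁] at h
    ext j
    have := congrFun h j
    simpa [R] using this
  let S : ∀ i j : Fin t, Matrix (Fin (n i)) (Fin (n j)) ℂ := fun k i =>
    if h : k = i then Matrix.of fun d c => D i c (Fin.cast (congrArg n h) d)
    else if k < i then Matrix.of fun d c => s i c k d else 0
  have hSd : ∀ i, S i i = Matrix.of fun d c => D i c d := fun i => by simp [S]
  have hSlt : ∀ k i, k < i → S k i = Matrix.of fun d c => s i c k d := fun k i h => by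
    simp [S, h, h.ne]
  have hSgt : ∀ k i, i < k → S k i = 0 := fun k i h => by
    simp [S, h.not_gt, h.ne']
  refine ⟨rk, hm, hn, R, S,
    b.toMatrix_orthonormalBasis_mem_unitary _, hSgt, fun i => ?_, fun i => ?_⟩
  · have : S i i = (Pi.basisFun ℂ (Fin (n i))).toMatrix (D i) := by
      rw [hSd]
      ext d c
      simp [Basis.toMatrix_apply]
    rw [this]
    exact Basis.isUnit_det (Pi.basisFun ℂ (Fin (n i))) (D i)
  · have hcol : ∀ c, (R * ∑ k, A k * S k i).col c = (stairBlock t m n rk i).col c := by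
      intro c
      have h₁ : (R * ∑ k, A k * S k i).col c = R.mulVec (∑ k, (A k).mulVec ((S k i).col c)) := by
        ext row
        simp [Matrix.mul_apply, Matrix.mulVec, dotProduct, Matrix.sum_apply]
      have h₂ : e (∑ k, (A k).mulVec ((S k i).col c)) =
          if h : c.1 < rk i then u ⟨i, ⟨c, h⟩⟩ else 0 := by
        rw [← hD i c, map_sum, ← Finset.sum_subset (Finset.subset_univ (Finset.Iic i)),
          ← Finset.Iio_insert, Finset.sum_insert (by simp)]
        · congr 1
          · rw [hSd]
            rfl
          · refine Finset.sum_congr rfl fun k hk => ?_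
            rw [hSlt k i (Finset.mem_Iio.1 hk)]
            rfl
        · intro k _ hk
          rw [hSgt k i (by simpa using hk)]
          have : (0 : Matrix (Fin (n k)) (Fin (n i)) ℂ).col c = 0 := rfl
          rw [this, Matrix.mulVec_zero, map_zero]
      rw [h₁, hR, h₂, stairBlock_col hm]
      split_ifs with h
      · rw [← hbu, b.repr_self]
        ext j
        simp [ι, Pi.single_apply]
      · simp
    ext row c
    exact congrFun (hcol c) row

/-- Let `P = {p_1,…,p_t}` be a chain and `A = [A_1|…|A_t]` a block matrix over `ℂ` with `m`
rows.  Then there are an `m×m` unitary matrix `R`, an invertible block upper triangular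
matrix `S = [S_{ij}]` and nonnegative integers `r_1,…,r_t` with `r_1+…+r_t ≤ m` (and
`r_i ≤ n_i`) such that `B = R·A·S` has the staircase form; moreover the integers
`r_1,…,r_t` are uniquely determined by `A`. -/
theorem chain_block_matrix_staircase_form
    (t m : ℕ) (r : Fin t → Fin t → Prop)
    (hchain : ∀ i j : Fin t, r i j ↔ i < j)
    (n : Fin t → ℕ) (A : ∀ i : Fin t, Matrix (Fin m) (Fin (n i)) ℂ) :
    ∃ rk : Fin t → ℕ,
      ((∑ i, rk i) ≤ m ∧ (∀ i, rk i ≤ n i) ∧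
        ∃ (R : Matrix (Fin m) (Fin m) ℂ)
          (S S' : ∀ i j : Fin t, Matrix (Fin (n i)) (Fin (n j)) ℂ),
          R ∈ Matrix.unitaryGroup (Fin m) ℂ ∧
          (∀ i j, j < i → S i j = 0) ∧
          (∀ i, ∑ k, S i k * S' k i = 1) ∧ (∀ i j, i ≠ j → ∑ k, S i k * S' k j = 0) ∧
          (∀ i, ∑ k, S' i k * S k i = 1) ∧ (∀ i j, i ≠ j → ∑ k, S' i k * S k j = 0) ∧
          (∀ i, R * ∑ k, A k * S k i = stairBlock t m n rk i)) ∧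
      -- uniqueness of the ranks `r_1, …, r_t`:
      (∀ rk' : Fin t → ℕ, (∑ i, rk' i) ≤ m → (∀ i, rk' i ≤ n i) →
        (∃ (R : Matrix (Fin m) (Fin m) ℂ)
          (S S' : ∀ i j : Fin t, Matrix (Fin (n i)) (Fin (n j)) ℂ),
          R ∈ Matrix.unitaryGroup (Fin m) ℂ ∧
          (∀ i j, j < i → S i j = 0) ∧
          (∀ i, ∑ k, S i k * S' k i = 1) ∧ (∀ i j, i ≠ j → ∑ k, S i k * S' k j = 0) ∧
          (∀ i, ∑ k, S' i k * S k i = 1) ∧ (∀ i j, i ≠ j → ∑ k, S' i k * S k j = 0) ∧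
          (∀ i, R * ∑ k, A k * S k i = stairBlock t m n rk' i)) →
        rk' = rk) := by
  obtain ⟨rk, hm, hn, R, S, hR, hS, hdiag, hB⟩ := exists_staircase_form A
  obtain ⟨S', h₁, h₂, h₃, h₄⟩ := exists_block_inverse S hS hdiag
  refine ⟨rk, ⟨hm, hn, R, S, S', hR, hS, h₁, h₂, h₃, h₄, hB⟩, ?_⟩
  rintro rk' hm' hn' ⟨R', T, T', hR', hT, g₁, g₂, -, -, hB'⟩
  refine eq_of_sum_Iic_eq fun i => ?_
  rw [sum_Iic_eq_finrank_blockColSpan hm' hn' hR' hT g₁ g₂ hB',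
    sum_Iic_eq_finrank_blockColSpan hm hn hR hS h₁ h₂ hB]
end
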